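/- Column-boundary sum for the two-step coefficients (k = d row): let λ be a Young diagram with at most d rows, let i, j ∈ [d], and assume λ + e_i is again a Young diagram, i.e. i = 1 or λ_{i−1} > λ_i. Set B_{ij} := (C_i − C_d) · D_{d→ij} − (C_i − C_d + 1) · D_{d−1→ij} and B_{ji} := (C_j − C_d) · D_{d→ij} − (C_j − C_d + 1) · D_{d−1→ij}. Then ∑_{ℓ=1}^{d} λ↑↑_ℓ · g(d, ℓ) = (1 − 1/Δ²) · B_{ji} + (1/Δ²) · B_{ij} + (C_d + 1) · (F(d, d) − F(d−1, d)). -/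

import Mathlib

open Finset

/-- The Weyl dimension polynomial `WD_p(mu) = prod_{1 <= a < b <= p} ((mu_a - mu_b) + (b - a))/(b - a)`
of the integer tuple `(mu 1, ..., mu p)`. -/
def weylDim (p : ℕ) (μ : ℕ → ℤ) : ℚ :=
  ∏ a ∈ Finset.Icc 1 p, ∏ b ∈ Finset.Icc (a + 1) p,
    (((μ a : ℚ) - (μ b : ℚ)) + ((b : ℚ) - (a : ℚ))) / ((b : ℚ) - (a : ℚ))

/-- `addBox μ y = μ + e_y`: the tuple `μ` with `1` added in coordinate `y`. -/
def addBox (μ : ℕ → ℤ) (y : ℕ) : ℕ → ℤ := fun x => μ x + if x = y then 1 else 0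

/-- The dimension ratio `D^μ_{k→y} = WD_k(μ + e_y)/WD_k(μ)` for `y ≤ k`, and `0` for `k < y`
(division by zero evaluates to `0`). -/
def dimRatio (μ : ℕ → ℤ) (k y : ℕ) : ℚ :=
  if y ≤ k then weylDim k (addBox μ y) / weylDim k μ else 0

def intOf (lam : ℕ → ℕ) : ℕ → ℤ := fun x => (lam x : ℤ)

/-- `Δ = (λ_j − λ_i) + (i − j) + δ_{ij}`. -/
def Del (lam : ℕ → ℕ) (i j : ℕ) : ℚ :=
  (((lam j : ℚ) - (lam i : ℚ)) + ((i : ℚ) - (j : ℚ))) + (if i = j then 1 else 0)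

/-- The partial-sum function `F(s, t)` of squared two-step Clebsch–Gordan coefficients. -/
def Fcoef (lam : ℕ → ℕ) (i j : ℕ) (s t : ℕ) : ℚ :=
  if s ≤ t then dimRatio (intOf lam) s i * dimRatio (addBox (intOf lam) i) t j
  else
    dimRatio (intOf lam) t j * dimRatio (addBox (intOf lam) j) s i
      + 1 / Del lam i j ^ 2 *
          (dimRatio (intOf lam) t i * dimRatio (addBox (intOf lam) i) s j
            - dimRatio (intOf lam) t j * dimRatio (addBox (intOf lam) j) s i)

/-- The squared two-step Clebsch–Gordan coefficient `g(k, ℓ)`. -/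
def gcoef (lam : ℕ → ℕ) (i j : ℕ) (k l : ℕ) : ℚ :=
  Fcoef lam i j k l - Fcoef lam i j (k - 1) l - Fcoef lam i j k (l - 1)
    + Fcoef lam i j (k - 1) (l - 1)

/-- `D_{s→ij}`. -/
def dimR2 (lam : ℕ → ℕ) (i j s : ℕ) : ℚ :=
  if max i j ≤ s then weylDim s (addBox (addBox (intOf lam) i) j) / weylDim s (intOf lam)
  else 0

/-- `C^{λ+e_i}_j = λ_j + δ_{ij} − j`. -/
def rowContentAdd (lam : ℕ → ℕ) (i j : ℕ) : ℚ :=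
  ((lam j : ℚ) + (if i = j then 1 else 0)) - (j : ℚ)

/-- The content `C_x = λ_x − x` of row `x`. -/
def rowContent (lam : ℕ → ℕ) (x : ℕ) : ℚ := (lam x : ℚ) - (x : ℚ)

/-- The staircase transformation `λ↑↑_k = λ_k + d − 2k + 1`. -/
def staircase (d : ℕ) (lam : ℕ → ℕ) (k : ℕ) : ℤ :=
  (lam k : ℤ) + (d : ℤ) - 2 * (k : ℤ) + 1

/-- `lam` is weakly decreasing on rows `1, ..., d`. -/
lemma le_of_row_le {d : ℕ} {lam : ℕ → ℕ}
    (hlam : ∀ k, 1 ≤ k → k + 1 ≤ d → lam (k + 1) ≤ lam k)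
    {a b : ℕ} (ha : 1 ≤ a) (hab : a ≤ b) (hb : b ≤ d) : lam b ≤ lam a := by
  induction b, hab using Nat.le_induction with
  | base => exact le_rfl
  | succ n hn ih => exact (hlam n (by omega) hb).trans (ih (by omega))

lemma weylDim_ne_zero_iff {p : ℕ} {μ : ℕ → ℤ} :
    weylDim p μ ≠ 0 ↔ ∀ a b, 1 ≤ a → a < b → b ≤ p → (μ a - μ b) + ((b : ℤ) - a) ≠ 0 := by
  simp only [weylDim, Finset.prod_ne_zero_iff, Finset.mem_Icc]
  constructor
  · intro h a b ha hab hb h0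
    refine h a ⟨ha, by omega⟩ b ⟨by omega, hb⟩ ?_
    rw [div_eq_zero_iff]
    left
    exact_mod_cast h0
  · rintro h a ⟨ha, -⟩ b ⟨hab, hb⟩ h0
    rw [div_eq_zero_iff] at h0
    rcases h0 with h0 | h0
    · exact h a b ha (by omega) hb (by exact_mod_cast h0)
    · have : (b : ℤ) - a = 0 := by exact_mod_cast h0
      omega

lemma weylDim_succ (p : ℕ) (μ : ℕ → ℤ) :
    weylDim (p + 1) μ = weylDim p μ * ∏ a ∈ Finset.Icc 1 p,
      (((μ a : ℚ) - (μ (p + 1) : ℚ)) + (((p + 1 : ℕ) : ℚ) - (a : ℚ))) /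
        (((p + 1 : ℕ) : ℚ) - (a : ℚ)) := by
  unfold weylDim
  rw [Finset.prod_Icc_succ_top (by omega), Finset.Icc_eq_empty (a := p + 1 + 1) (by omega),
    Finset.prod_empty, mul_one, ← Finset.prod_mul_distrib]
  refine Finset.prod_congr rfl fun a ha => ?_
  rw [Finset.mem_Icc] at ha
  rw [Finset.prod_Icc_succ_top (by omega)]

lemma addBox_comm (μ : ℕ → ℤ) (i j : ℕ) :
    addBox (addBox μ i) j = addBox (addBox μ j) i := by
  funext x
  simp only [addBox]
  ring

lemma weylDim_intOf_ne_zero {d s : ℕ} {lam : ℕ → ℕ}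
    (hlam : ∀ k, 1 ≤ k → k + 1 ≤ d → lam (k + 1) ≤ lam k) (hs : s ≤ d) :
    weylDim s (intOf lam) ≠ 0 := by
  rw [weylDim_ne_zero_iff]
  intro a b ha hab hb
  have := le_of_row_le hlam ha hab.le (hb.trans hs)
  simp only [intOf]
  omega

lemma weylDim_addBox_ne_zero {d s i : ℕ} {lam : ℕ → ℕ}
    (hlam : ∀ k, 1 ≤ k → k + 1 ≤ d → lam (k + 1) ≤ lam k)
    (hvalid : i = 1 ∨ lam i < lam (i - 1)) (hs : s ≤ d) :
    weylDim s (addBox (intOf lam) i) ≠ 0 := by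
  rw [weylDim_ne_zero_iff]
  intro a b ha hab hb h0
  have := le_of_row_le hlam ha hab.le (hb.trans hs)
  simp only [intOf, addBox] at h0
  have hbi : b = i := by by_contra h; rw [if_neg h] at h0; split_ifs at h0 <;> omega
  have hai : a ≠ i := by omega
  rw [if_neg hai, if_pos hbi] at h0
  have hab' : a = i - 1 := by omega
  rw [hab', hbi] at h0
  omega

/-- Adding a row changes the dimension ratio by one explicit factor. -/
lemma dimRatio_succ {d n y : ℕ} {lam : ℕ → ℕ}
    (hlam : ∀ k, 1 ≤ k → k + 1 ≤ d → lam (k + 1) ≤ lam k) (hy : 1 ≤ y) (hn : n + 1 ≤ d) :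
    (rowContent lam y - rowContent lam (n + 1)) * dimRatio (intOf lam) (n + 1) y
      = (rowContent lam y - rowContent lam (n + 1) + 1) * dimRatio (intOf lam) n y := by
  rcases Nat.lt_or_ge n y with h | h
  · rw [dimRatio, dimRatio, if_neg (show ¬ y ≤ n by omega)]
    rcases (show n + 1 ≤ y by omega).eq_or_lt with h' | h'
    · rw [h']; ring
    · rw [if_neg (by omega)]; ring
  have h1 := weylDim_intOf_ne_zero hlam (show n ≤ d by omega)
  have h2 := weylDim_intOf_ne_zero hlam hn
  rw [dimRatio, dimRatio, if_pos h, if_pos (by omega), mul_div_assoc', mul_div_assoc',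
    div_eq_div_iff h2 h1, weylDim_succ, weylDim_succ]
  have hmem : y ∈ Finset.Icc 1 n := Finset.mem_Icc.2 ⟨hy, h⟩
  rw [← Finset.mul_prod_erase _ _ hmem, ← Finset.mul_prod_erase _ _ hmem]
  have hprod : ∀ a ∈ (Finset.Icc 1 n).erase y,
      (((addBox (intOf lam) y a : ℤ) : ℚ) - ((addBox (intOf lam) y (n + 1) : ℤ) : ℚ)
        + (((n + 1 : ℕ) : ℚ) - (a : ℚ))) / (((n + 1 : ℕ) : ℚ) - (a : ℚ))
      = (((intOf lam a : ℤ) : ℚ) - ((intOf lam (n + 1) : ℤ) : ℚ)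
        + (((n + 1 : ℕ) : ℚ) - (a : ℚ))) / (((n + 1 : ℕ) : ℚ) - (a : ℚ)) := by
    intro a ha
    rw [addBox, addBox, if_neg (Finset.ne_of_mem_erase ha), if_neg (by omega), add_zero, add_zero]
  rw [Finset.prod_congr rfl hprod, addBox, addBox, if_pos rfl, if_neg (by omega : n + 1 ≠ y)]
  simp only [intOf, rowContent]
  push_cast
  ring

lemma sum_dimRatio {d j : ℕ} {lam : ℕ → ℕ}
    (hlam : ∀ k, 1 ≤ k → k + 1 ≤ d → lam (k + 1) ≤ lam k) (hj : 1 ≤ j)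
    (n : ℕ) (hn : n + 1 ≤ d) :
    ∑ l ∈ Finset.Icc 1 n,
        (rowContent lam l - rowContent lam (l + 1) + 1) * dimRatio (intOf lam) l j
      = (rowContent lam j - rowContent lam (n + 1) + 1) * dimRatio (intOf lam) n j := by
  induction n with
  | zero => simp [dimRatio, show j ≠ 0 by omega]
  | succ n ih =>
    rw [Finset.sum_Icc_succ_top (by omega), ih (by omega)]
    linear_combination -dimRatio_succ hlam hj (show n + 1 ≤ d by omega)

lemma dimRatio_mul_dimRatio {i j s : ℕ} {lam : ℕ → ℕ}
    (h : weylDim s (addBox (intOf lam) i) ≠ 0) :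
    dimRatio (intOf lam) s i * dimRatio (addBox (intOf lam) i) s j = dimR2 lam i j s := by
  by_cases hi : i ≤ s <;> by_cases hj : j ≤ s <;> simp only [dimRatio, dimR2, hi, hj, max_le_iff,
    if_true, if_false, and_true, and_false, mul_zero, zero_mul]
  field_simp

/-- When `λ + e_j` is not a diagram, either `λ + e_i + e_j` has dimension zero or `Δ² = 1`. -/
lemma one_sub_mul_dimRatio_mul_dimRatio {d i j s : ℕ} {lam : ℕ → ℕ}
    (hlam : ∀ k, 1 ≤ k → k + 1 ≤ d → lam (k + 1) ≤ lam k)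
    (hvalid : i = 1 ∨ lam i < lam (i - 1)) (hs : s ≤ d) :
    (1 - 1 / Del lam i j ^ 2) *
        (dimRatio (intOf lam) s j * dimRatio (addBox (intOf lam) j) s i)
      = (1 - 1 / Del lam i j ^ 2) * dimR2 lam i j s := by
  by_cases h : weylDim s (addBox (intOf lam) j) = 0
  swap
  · rw [dimRatio_mul_dimRatio h, dimR2, dimR2, max_comm, addBox_comm]
  have hz := h
  rw [← not_ne_iff, weylDim_ne_zero_iff] at hz
  push Not at hz
  obtain ⟨a, b, ha, hab, hb, h0⟩ := hz
  have hle := le_of_row_le hlam ha hab.le (hb.trans hs)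
  simp only [intOf, addBox] at h0
  have hbj : b = j := by by_contra h; rw [if_neg h] at h0; split_ifs at h0 <;> omega
  rw [if_neg (by omega), if_pos hbj] at h0
  have haj : j = a + 1 := by omega
  have heq : lam a = lam j := by subst hbj; omega
  have hij : i ≠ j := by
    rintro rfl
    rw [haj, Nat.add_sub_cancel, ← haj] at hvalid
    omega
  have hzero : dimRatio (intOf lam) s j = 0 := by simp [dimRatio, h]
  rw [hzero, zero_mul, mul_zero]
  by_cases hia : i = a
  · have : Del lam i j = -1 := by
      rw [Del, if_neg hij, hia, heq, haj]
      push_cast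
      ring
    rw [this]
    norm_num
  · have : weylDim s (addBox (addBox (intOf lam) i) j) = 0 := by
      rw [← not_ne_iff, weylDim_ne_zero_iff]
      intro H
      refine H a j ha (by omega) (by omega) ?_
      simp only [intOf, addBox, if_neg (Ne.symm hia), if_neg hij.symm, if_true,
        if_neg (show a ≠ j by omega), heq]
      omega
    simp [dimR2, this]

lemma Fcoef_of_le {d i j s t : ℕ} {lam : ℕ → ℕ}
    (hlam : ∀ k, 1 ≤ k → k + 1 ≤ d → lam (k + 1) ≤ lam k)
    (hvalid : i = 1 ∨ lam i < lam (i - 1)) (hs : s ≤ d) (hts : t ≤ s) :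
    Fcoef lam i j s t
      = (1 - 1 / Del lam i j ^ 2) *
          (dimRatio (intOf lam) t j * dimRatio (addBox (intOf lam) j) s i)
        + 1 / Del lam i j ^ 2 *
          (dimRatio (intOf lam) t i * dimRatio (addBox (intOf lam) i) s j) := by
  rcases hts.eq_or_lt with rfl | h
  · rw [Fcoef, if_pos le_rfl, one_sub_mul_dimRatio_mul_dimRatio hlam hvalid hs,
      dimRatio_mul_dimRatio (weylDim_addBox_ne_zero hlam hvalid hs)]
    ring
  · rw [Fcoef, if_neg (by omega)]
    ring

lemma sum_Icc_mul_sub {R : Type*} [CommRing R] (c G : ℕ → R) (hG : G 0 = 0) (n : ℕ) :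
    ∑ l ∈ Finset.Icc 1 (n + 1), c l * (G l - G (l - 1))
      = c (n + 1) * G (n + 1) + ∑ l ∈ Finset.Icc 1 n, (c l - c (l + 1)) * G l := by
  induction n with
  | zero => simp [hG]
  | succ n ih =>
    rw [Finset.sum_Icc_succ_top (by omega), ih, Finset.sum_Icc_succ_top (b := n) (by omega),
      Nat.add_sub_cancel]
    ring

lemma sum_Fcoef {d n i j s : ℕ} {lam : ℕ → ℕ}
    (hlam : ∀ k, 1 ≤ k → k + 1 ≤ d → lam (k + 1) ≤ lam k)
    (hvalid : i = 1 ∨ lam i < lam (i - 1)) (hi : 1 ≤ i) (hj : 1 ≤ j)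
    (hn : n + 1 ≤ d) (hs : s ≤ d) (hns : n ≤ s) :
    ∑ l ∈ Finset.Icc 1 n,
        (rowContent lam l - rowContent lam (l + 1) + 1) * Fcoef lam i j s l
      = (1 - 1 / Del lam i j ^ 2) * (dimRatio (addBox (intOf lam) j) s i *
          ((rowContent lam j - rowContent lam (n + 1) + 1) * dimRatio (intOf lam) n j))
        + 1 / Del lam i j ^ 2 * (dimRatio (addBox (intOf lam) i) s j *
          ((rowContent lam i - rowContent lam (n + 1) + 1) * dimRatio (intOf lam) n i)) := by
  rw [← sum_dimRatio hlam hj n hn, ← sum_dimRatio hlam hi n hn]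
  simp only [Finset.mul_sum]
  rw [← Finset.sum_add_distrib]
  refine Finset.sum_congr rfl fun l hl => ?_
  rw [Fcoef_of_le hlam hvalid hs ((Finset.mem_Icc.1 hl).2.trans hns)]
  ring

theorem column_boundary_two_step_sum
    (d : ℕ) (hd : 1 ≤ d) (lam : ℕ → ℕ)
    (hlam : ∀ k, 1 ≤ k → k + 1 ≤ d → lam (k + 1) ≤ lam k)
    (i j : ℕ) (hi : i ∈ Finset.Icc 1 d) (hj : j ∈ Finset.Icc 1 d)
    (hvalid : i = 1 ∨ lam i < lam (i - 1)) :
    ∑ l ∈ Finset.Icc 1 d, (staircase d lam l : ℚ) * gcoef lam i j d l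
      = (1 - 1 / Del lam i j ^ 2) *
            ((rowContent lam j - rowContent lam d) * dimR2 lam i j d
              - (rowContent lam j - rowContent lam d + 1) * dimR2 lam i j (d - 1))
          + 1 / Del lam i j ^ 2 *
            ((rowContent lam i - rowContent lam d) * dimR2 lam i j d
              - (rowContent lam i - rowContent lam d + 1) * dimR2 lam i j (d - 1))
          + (rowContent lam d + 1) * (Fcoef lam i j d d - Fcoef lam i j (d - 1) d) := by
  rw [Finset.mem_Icc] at hi hj
  obtain ⟨n, rfl⟩ : ∃ n, d = n + 1 := ⟨d - 1, by omega⟩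
  rw [Nat.add_sub_cancel]
  have hF : ∀ s, Fcoef lam i j s 0 = 0 := by
    intro s
    simp [Fcoef, dimRatio, show i ≠ 0 by omega, show j ≠ 0 by omega]
  have habel := sum_Icc_mul_sub (fun l => (staircase (n + 1) lam l : ℚ))
    (fun l => Fcoef lam i j (n + 1) l - Fcoef lam i j n l) (by simp [hF]) n
  have hL : ∑ l ∈ Finset.Icc 1 (n + 1), (staircase (n + 1) lam l : ℚ) * gcoef lam i j (n + 1) l
      = ∑ l ∈ Finset.Icc 1 (n + 1), (staircase (n + 1) lam l : ℚ) *
        ((Fcoef lam i j (n + 1) l - Fcoef lam i j n l)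
          - (Fcoef lam i j (n + 1) (l - 1) - Fcoef lam i j n (l - 1))) := by
    refine Finset.sum_congr rfl fun l _ => ?_
    rw [gcoef, Nat.add_sub_cancel]
    ring
  have hR : ∑ l ∈ Finset.Icc 1 n,
      ((staircase (n + 1) lam l : ℚ) - (staircase (n + 1) lam (l + 1) : ℚ)) *
        (Fcoef lam i j (n + 1) l - Fcoef lam i j n l)
      = ∑ l ∈ Finset.Icc 1 n,
          (rowContent lam l - rowContent lam (l + 1) + 1) * Fcoef lam i j (n + 1) l
        - ∑ l ∈ Finset.Icc 1 n,
          (rowContent lam l - rowContent lam (l + 1) + 1) * Fcoef lam i j n l := by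
    rw [← Finset.sum_sub_distrib]
    refine Finset.sum_congr rfl fun l _ => ?_
    simp only [staircase, rowContent]
    push_cast
    ring
  have hlast : (staircase (n + 1) lam (n + 1) : ℚ) = rowContent lam (n + 1) + 1 := by
    simp only [staircase, rowContent]
    push_cast
    ring
  rw [hL, habel, hR, hlast, sum_Fcoef hlam hvalid hi.1 hj.1 le_rfl le_rfl (Nat.le_succ n),
    sum_Fcoef hlam hvalid hi.1 hj.1 le_rfl (Nat.le_succ n) le_rfl]
  have hj₁ := dimRatio_succ hlam hj.1 (le_refl (n + 1))
  have hi₁ := dimRatio_succ hlam hi.1 (le_refl (n + 1))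
  have hd₁ := dimRatio_mul_dimRatio (j := j) (weylDim_addBox_ne_zero hlam hvalid (le_refl (n + 1)))
  have hd₀ := dimRatio_mul_dimRatio (j := j) (weylDim_addBox_ne_zero hlam hvalid (Nat.le_succ n))
  have he₁ := one_sub_mul_dimRatio_mul_dimRatio (j := j) hlam hvalid (le_refl (n + 1))
  have he₀ := one_sub_mul_dimRatio_mul_dimRatio (j := j) hlam hvalid (Nat.le_succ n)
  linear_combination
    (rowContent lam j - rowContent lam (n + 1)) * he₁
    - (rowContent lam j - rowContent lam (n + 1) + 1) * he₀
    + 1 / Del lam i j ^ 2 * (rowContent lam i - rowContent lam (n + 1)) * hd₁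
    - 1 / Del lam i j ^ 2 * (rowContent lam i - rowContent lam (n + 1) + 1) * hd₀
    - (1 - 1 / Del lam i j ^ 2) * dimRatio (addBox (intOf lam) j) (n + 1) i * hj₁
    - 1 / Del lam i j ^ 2 * dimRatio (addBox (intOf lam) i) (n + 1) j * hi₁
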